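/- Let q be an even prime power, q > 2. A Kakeya set K = ⋃_d L_d in AG(2,q) satisfies |K| = q(q+1)/2 if and only if no point of AG(2,q) lies on three or more of the defining lines L_d (equivalently, K is the Kakeya set associated to a dual hyperoval and one of its lines). -/

import Mathlib

/-- `L` is an affine line in `AG(2,q) = F × F` with direction `d`, where the
`q+1` directions are indexed by `Option F`: `some m` is the parallel class of
lines of slope `m`, and `none` is the parallel class of vertical lines. -/
def IsLineWithDir {F : Type*} [Field F] (d : Option F) (L : Set (F × F)) : Prop :=
  match d with
  | none => ∃ c : F, L = {p : F × F | p.1 = c}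
  | some m => ∃ b : F, L = {p : F × F | p.2 = m * p.1 + b}

lemma kak_card_line {F : Type*} [Field F] [Fintype F] (d : Option F) (L : Set (F × F))
    (h : IsLineWithDir d L) : L.ncard = Fintype.card F := by
  rw [← Nat.card_eq_fintype_card, ← Set.ncard_univ]
  cases d with
  | none =>
    obtain ⟨c, rfl⟩ := h
    have : {p : F × F | p.1 = c} = (fun y : F => (c, y)) '' Set.univ := by
      ext ⟨x, y⟩; simp [eq_comm]
    rw [this, Set.ncard_image_of_injective]
    intro a b hab; simpa using hab
  | some m =>
    obtain ⟨b, rfl⟩ := h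
    have : {p : F × F | p.2 = m * p.1 + b} = (fun x : F => (x, m * x + b)) '' Set.univ := by
      ext ⟨x, y⟩; simp [eq_comm]
    rw [this, Set.ncard_image_of_injective]
    intro a b hab; exact (Prod.ext_iff.1 hab).1

lemma kak_card_inter {F : Type*} [Field F] (d e : Option F) (hde : d ≠ e)
    (L M : Set (F × F)) (h : IsLineWithDir d L) (h' : IsLineWithDir e M) :
    (L ∩ M).ncard = 1 := by
  rw [Set.ncard_eq_one]
  cases d with
  | none =>
    obtain ⟨c, rfl⟩ := h
    cases e with
    | none => exact absurd rfl hde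
    | some m =>
      obtain ⟨b, rfl⟩ := h'
      refine ⟨(c, m * c + b), ?_⟩
      ext ⟨x, y⟩
      simp only [Set.mem_inter_iff, Set.mem_ofPred_eq, Set.mem_singleton_iff, Prod.mk.injEq]
      constructor
      · rintro ⟨rfl, rfl⟩; simp
      · rintro ⟨rfl, rfl⟩; simp
  | some n =>
    obtain ⟨a, rfl⟩ := h
    cases e with
    | none =>
      obtain ⟨c, rfl⟩ := h'
      refine ⟨(c, n * c + a), ?_⟩
      ext ⟨x, y⟩
      simp only [Set.mem_inter_iff, Set.mem_ofPred_eq, Set.mem_singleton_iff, Prod.mk.injEq]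
      constructor
      · rintro ⟨rfl, rfl⟩; simp
      · rintro ⟨rfl, rfl⟩; simp
    | some m =>
      obtain ⟨b, rfl⟩ := h'
      have hnm : n - m ≠ 0 := fun h0 => hde (by rw [sub_eq_zero.1 h0])
      refine ⟨((b - a) / (n - m), n * ((b - a) / (n - m)) + a), ?_⟩
      ext ⟨x, y⟩
      simp only [Set.mem_inter_iff, Set.mem_ofPred_eq, Set.mem_singleton_iff, Prod.mk.injEq]
      constructor
      · rintro ⟨rfl, h2⟩
        have : x = (b - a) / (n - m) := by
          rw [eq_div_iff hnm]; linear_combination h2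
        rw [← this]; simp
      · rintro ⟨hx, rfl⟩
        rw [← hx]
        rw [eq_div_iff hnm] at hx
        exact ⟨rfl, by linear_combination hx⟩

theorem kakeya_even_equality_iff {F : Type*} [Field F] [Fintype F] (q : ℕ)
    (hq : Fintype.card F = q) (heven : Even q) (hq2 : 2 < q)
    (L : Option F → Set (F × F)) (hL : ∀ d, IsLineWithDir d (L d))
    (K : Set (F × F)) (hK : K = ⋃ d, L d) :
    2 * K.ncard = q * (q + 1) ↔
      ∀ A : F × F, Nat.card {d : Option F // A ∈ L d} ≤ 2 := by
  classical
  let i : F × F → Option F → ℤ := fun A d => if A ∈ L d then 1 else 0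
  let m : F × F → ℕ := fun A => Nat.card {d : Option F // A ∈ L d}
  have hsum : ∀ S : Set (F × F), ∑ A, (if A ∈ S then (1 : ℤ) else 0) = S.ncard := by
    intro S
    rw [Set.ncard_eq_toFinset_card']
    simp [Finset.sum_boole, Set.toFinset]
  have hm : ∀ A, (m A : ℤ) = ∑ d, i A d := by
    intro A
    simp [m, i, Finset.sum_boole, Nat.card_eq_fintype_card, Fintype.card_subtype]
  have h1 : ∑ A, (m A : ℤ) = (q + 1) * q := by
    simp_rw [hm]
    rw [Finset.sum_comm]
    simp_rw [i, hsum, kak_card_line _ _ (hL _), hq]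
    simp [hq]
  have h2 : ∑ A, (m A : ℤ) ^ 2 = (q + 1) * (q + q) := by
    have e : ∀ A, (m A : ℤ) ^ 2 = ∑ d, ∑ d', (if A ∈ L d ∩ L d' then (1 : ℤ) else 0) := by
      intro A
      rw [hm, sq, Finset.sum_mul_sum]
      refine Finset.sum_congr rfl fun d _ => Finset.sum_congr rfl fun d' _ => ?_
      by_cases a : A ∈ L d <;> by_cases b : A ∈ L d' <;> simp [i, a, b]
    simp_rw [e]
    rw [Finset.sum_comm]
    have e2 : ∀ d, ∑ A, ∑ d', (if A ∈ L d ∩ L d' then (1 : ℤ) else 0) = q + q := by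
      intro d
      rw [Finset.sum_comm]
      rw [Finset.sum_congr rfl (g := fun d' => ((L d ∩ L d').ncard : ℤ))
        (fun d' _ => by rw [← hsum]; congr!)]
      rw [← Finset.add_sum_erase _ _ (Finset.mem_univ d), Set.inter_self,
        kak_card_line _ _ (hL _), hq]
      congr 1
      rw [Finset.sum_congr rfl (g := fun _ => (1 : ℤ))]
      · simp [Finset.card_erase_of_mem, hq]
      · intro d' hd'
        rw [kak_card_inter d d' (Finset.ne_of_mem_erase hd').symm _ _ (hL _) (hL _)]
        rfl
    simp_rw [e2]
    simp [hq]
  have hK0 : ∀ A, A ∈ K ↔ m A ≠ 0 := by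
    intro A
    subst hK
    simp [m, Nat.card_eq_fintype_card, Fintype.card_eq_zero_iff, isEmpty_subtype]
  let f : F × F → ℤ := fun A => (m A : ℤ) ^ 2 - 3 * m A + 2 * (if A ∈ K then (1 : ℤ) else 0)
  have hf : ∑ A, f A = 2 * K.ncard - q * (q + 1) := by
    simp only [f, Finset.sum_add_distrib, Finset.sum_sub_distrib, ← Finset.mul_sum, h1, h2, hsum]
    ring
  have hf1 : ∀ A, 0 ≤ f A ∧ (f A = 0 ↔ m A ≤ 2) := by
    intro A
    simp only [f, hK0]
    rcases Nat.lt_or_ge (m A) 3 with h | h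
    · interval_cases m A <;> simp
    · have h3 : (3 : ℤ) ≤ m A := by exact_mod_cast h
      have h0 : m A ≠ 0 := by omega
      simp only [h0, ne_eq, not_false_eq_true, if_true]
      refine ⟨by nlinarith, fun h' => by nlinarith, fun h' => by omega⟩
  have : 2 * K.ncard = q * (q + 1) ↔ ∑ A, f A = 0 := by
    rw [hf, sub_eq_zero]; norm_cast
  rw [this, Finset.sum_eq_zero_iff_of_nonneg fun A _ => (hf1 A).1]
  simp only [Finset.mem_univ, true_imp_iff, (hf1 _).2, m]
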